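/- For every complex number q with |q| < 1, Σ_{n=1}^∞ ε₆₀(n) · q^{(n²−1)/120} = 2 − Σ_{n=0}^∞ (−1)^n q^{n(3n−1)/2} / ∏_{k=1}^{n} (1 − q^{n+k}), where ε₆₀(n) = 1 if n ≡ 1, 11, 19 or 29 (mod 60), ε₆₀(n) = −1 if n ≡ 31, 41, 49 or 59 (mod 60), and ε₆₀(n) = 0 otherwise; note that (n² − 1)/120 is a nonnegative integer whenever ε₆₀(n) ≠ 0, and both series converge absolutely. -/

import Mathlib

/-- `ε₆₀(n)`: `+1` if `n ≡ 1, 11, 19, 29 (mod 60)`,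
`−1` if `n ≡ 31, 41, 49, 59 (mod 60)`, else `0`. -/
def eps60 (n : ℕ) : ℤ :=
  if n % 60 = 1 ∨ n % 60 = 11 ∨ n % 60 = 19 ∨ n % 60 = 29 then 1
  else if n % 60 = 31 ∨ n % 60 = 41 ∨ n % 60 = 49 ∨ n % 60 = 59 then -1 else 0

/-- The finite `q`-Pochhammer symbol `(q; q)_n`. -/
noncomputable def qPoch (q : ℂ) (n : ℕ) : ℂ := ∏ k ∈ Finset.range n, (1 - q ^ (k + 1))

/-- The reciprocal `1 / (q; q)_k`, extended by zero to negative `k`. -/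
noncomputable def qPochInv (q : ℂ) (k : ℤ) : ℂ := if k < 0 then 0 else (qPoch q k.toNat)⁻¹

/-- The bilateral sum `∑ q^(3r² + ar) / ((q; q)_{x-3r} (q; q)_{y+3r})`. -/
noncomputable def bilatSum (q : ℂ) (a x y : ℤ) : ℂ :=
  ∑' r : ℤ, q ^ (3 * r ^ 2 + a * r) * (qPochInv q (x - 3 * r) * qPochInv q (y + 3 * r))

lemma one_sub_pow_ne_zero {q : ℂ} (hq : ‖q‖ < 1) {n : ℕ} (hn : n ≠ 0) : 1 - q ^ n ≠ 0 := by
  intro h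
  have h1 : ‖q ^ n‖ < 1 := by
    rw [norm_pow]
    exact pow_lt_one₀ (norm_nonneg _) hq hn
  rw [← sub_eq_zero.mp h] at h1
  simp at h1

lemma qPoch_succ (q : ℂ) (n : ℕ) : qPoch q (n + 1) = qPoch q n * (1 - q ^ (n + 1)) :=
  Finset.prod_range_succ _ _

lemma qPoch_ne_zero {q : ℂ} (hq : ‖q‖ < 1) (n : ℕ) : qPoch q n ≠ 0 :=
  Finset.prod_ne_zero_iff.mpr fun _ _ => one_sub_pow_ne_zero hq (Nat.succ_ne_zero _)

lemma qPochInv_of_neg (q : ℂ) {k : ℤ} (hk : k < 0) : qPochInv q k = 0 := if_pos hk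

lemma qPochInv_natCast (q : ℂ) (n : ℕ) : qPochInv q n = (qPoch q n)⁻¹ := by
  simp [qPochInv]

lemma one_sub_zpow_mul_qPochInv {q : ℂ} (hq : ‖q‖ < 1) (k : ℤ) :
    (1 - q ^ k) * qPochInv q k = qPochInv q (k - 1) := by
  rcases lt_trichotomy k 0 with hk | rfl | hk
  · rw [qPochInv_of_neg q hk, qPochInv_of_neg q (by omega), mul_zero]
  · rw [qPochInv_of_neg q (by omega : (0 : ℤ) - 1 < 0)]
    simp
  · obtain ⟨n, rfl⟩ : ∃ n : ℕ, k = (n + 1 : ℕ) := ⟨(k - 1).toNat, by omega⟩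
    have h : ((n + 1 : ℕ) : ℤ) - 1 = (n : ℕ) := by omega
    have h0 := one_sub_pow_ne_zero hq (Nat.succ_ne_zero n)
    rw [h, qPochInv_natCast, qPochInv_natCast, qPoch_succ, zpow_natCast]
    have h1 := qPoch_ne_zero hq n
    field_simp

lemma summable_bilatSum (q : ℂ) (a x y : ℤ) :
    Summable fun r : ℤ =>
      q ^ (3 * r ^ 2 + a * r) * (qPochInv q (x - 3 * r) * qPochInv q (y + 3 * r)) := by
  refine summable_of_ne_finset_zero (s := Finset.Icc (-|y|) |x|) fun r hr => ?_
  have h : x - 3 * r < 0 ∨ y + 3 * r < 0 := by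
    by_contra! hcon
    refine hr (Finset.mem_Icc.mpr ⟨?_, ?_⟩)
    · have := le_abs_self y
      have := abs_nonneg y
      omega
    · have := le_abs_self x
      have := abs_nonneg x
      omega
  rcases h with h | h <;> simp [qPochInv_of_neg q h]

lemma bilatSum_pred_right {q : ℂ} (hq : ‖q‖ < 1) (h0 : q ≠ 0) (a x y : ℤ) :
    bilatSum q a x (y - 1) = bilatSum q a x y - q ^ y * bilatSum q (a + 3) x y := by
  unfold bilatSum
  rw [← tsum_mul_left, ← Summable.tsum_sub (summable_bilatSum q a x y)
    ((summable_bilatSum q (a + 3) x y).mul_left _)]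
  refine tsum_congr fun r => ?_
  rw [show y - 1 + 3 * r = y + 3 * r - 1 by ring, ← one_sub_zpow_mul_qPochInv hq,
    show 3 * r ^ 2 + (a + 3) * r = 3 * r ^ 2 + a * r + 3 * r by ring, zpow_add₀ h0 y,
    zpow_add₀ h0 (3 * r ^ 2 + a * r)]
  ring

lemma bilatSum_symm (q : ℂ) (a x y : ℤ) : bilatSum q a x y = bilatSum q (-a) y x := by
  unfold bilatSum
  rw [← (Equiv.neg ℤ).tsum_eq]
  refine tsum_congr fun r => ?_
  simp only [Equiv.neg_apply]
  rw [mul_comm (qPochInv q _)]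
  ring_nf

lemma bilatSum_pred_left {q : ℂ} (hq : ‖q‖ < 1) (h0 : q ≠ 0) (a x y : ℤ) :
    bilatSum q a (x - 1) y = bilatSum q a x y - q ^ x * bilatSum q (a - 3) x y := by
  rw [bilatSum_symm q a, bilatSum_pred_right hq h0, bilatSum_symm q a x,
    bilatSum_symm q (a - 3), neg_sub, neg_add_eq_sub]

lemma bilatSum_shift {q : ℂ} (h0 : q ≠ 0) (a x y : ℤ) :
    bilatSum q a x y = q ^ (3 + a) * bilatSum q (a + 6) (x - 3) (y + 3) := by
  unfold bilatSum
  rw [← (Equiv.addRight (1 : ℤ)).tsum_eq, ← tsum_mul_left]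
  refine tsum_congr fun r => ?_
  simp only [Equiv.coe_addRight]
  rw [← mul_assoc (q ^ (3 + a)), ← zpow_add₀ h0]
  ring_nf

/-- The first half-step of the recursion for the differences of bilateral sums. -/
lemma bilatSum_half_step {q : ℂ} (hq : ‖q‖ < 1) (h0 : q ≠ 0) (n : ℤ) :
    bilatSum q 1 n n - bilatSum q 1 (n - 1) (n + 1) =
      (1 - q ^ (2 * n + 1)) * (bilatSum q (-1) n (n + 1) - bilatSum q 1 (n - 1) (n + 2)) := by
  have e1 := bilatSum_pred_right hq h0 1 (n - 1) (n + 2)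
  have e3 := bilatSum_pred_right hq h0 (-1) n (n + 1)
  have e4 := bilatSum_pred_right hq h0 2 (n - 1) (n + 2)
  have e5 := bilatSum_pred_left hq h0 2 n (n + 1)
  have s1 := (bilatSum_symm q 4 (n - 1) (n + 2)).trans (bilatSum_shift h0 _ _ _)
  have s2 := (bilatSum_symm q 5 (n - 1) (n + 2)).trans (bilatSum_shift h0 _ _ _)
  have s3 := bilatSum_symm q 1 n n
  rw [show n + 2 - 1 = n + 1 by ring] at e1 e4
  rw [show n + 1 - 1 = n by ring] at e3
  rw [show n + 2 - 3 = n - 1 by ring, show n - 1 + 3 = n + 2 by ring] at s1 s2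
  rw [e4] at e5
  rw [e1, s3, e3]
  have z1 : q ^ (n + 1) = q ^ n * q := zpow_add_one₀ h0 n
  have z2 : q ^ (n + 2) = q ^ n * q ^ 2 := by rw [zpow_add₀ h0]; norm_cast
  have z3 : q ^ (2 * n + 1) = q ^ n * q ^ n * q := by rw [zpow_add_one₀ h0, two_mul, zpow_add₀ h0]
  have z4 : q ^ (3 + -4 : ℤ) = q⁻¹ := by norm_num
  have z5 : q ^ (3 + -5 : ℤ) = (q ^ 2)⁻¹ := by norm_cast
  norm_num only at e5 s1 s2 ⊢
  norm_num only at z4 z5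
  rw [z1, z2, z3]
  rw [z2] at e5
  rw [z4] at s1
  rw [z5] at s2
  rw [s2] at e5
  rw [s1]
  field_simp at e5 ⊢
  linear_combination (q ^ n * q) * e5

/-- The second half-step of the recursion for the differences of bilateral sums. -/
lemma bilatSum_half_step' {q : ℂ} (hq : ‖q‖ < 1) (h0 : q ≠ 0) (m : ℤ) :
    (1 - q ^ (2 * m)) * (bilatSum q 1 m m - bilatSum q 1 (m - 1) (m + 1)) =
      q ^ (2 * m - 1) * (bilatSum q (-1) (m - 1) m - bilatSum q 1 (m - 2) (m + 1)) := by
  have r1 := bilatSum_pred_left hq h0 1 m m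
  have r1' := bilatSum_pred_right hq h0 1 (m - 1) (m + 1)
  have r2 := bilatSum_pred_left hq h0 2 m m
  have r2' := bilatSum_pred_right hq h0 2 (m - 1) (m + 1)
  have r3 := bilatSum_pred_left hq h0 2 (m - 1) (m + 1)
  have r3' := bilatSum_pred_right hq h0 2 (m - 2) (m + 2)
  have c1 := bilatSum_pred_right hq h0 (-1) (m - 1) (m + 1)
  have c2 := bilatSum_pred_right hq h0 1 (m - 2) (m + 2)
  have t1 (a : ℤ) := (bilatSum_symm q a (m - 2) (m + 2)).trans (bilatSum_shift h0 _ _ _)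
  have s1 := bilatSum_symm q (-1) m m
  have s2 := bilatSum_symm q 2 m m
  rw [show m + 1 - 1 = m by ring] at r1' r2' c1
  rw [show m + 2 - 1 = m + 1 by ring] at r3' c2
  rw [show m - 1 - 1 = m - 2 by ring] at r3
  rw [show m + 2 - 3 = m - 1 by ring, show m - 2 + 3 = m + 1 by ring] at t1
  rw [t1, t1] at c2 r3'
  have z1 : q ^ (m + 1) = q ^ m * q := zpow_add_one₀ h0 m
  have z2 : q ^ (m + 2) = q ^ m * q ^ 2 := by rw [zpow_add₀ h0]; norm_cast
  have z3 : q ^ (2 * m) = q ^ m * q ^ m := by rw [two_mul, zpow_add₀ h0]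
  have z3' : q ^ (2 * m - 1) = q ^ m * q ^ m / q := by rw [zpow_sub_one₀ h0, z3]; rfl
  have z4 : q ^ (m - 1) = q ^ m / q := zpow_sub_one₀ h0 m
  have y1 : q ^ (-2 : ℤ) = (q ^ 2)⁻¹ := by norm_cast
  have y2 : q ^ (-1 : ℤ) = q⁻¹ := by norm_num
  have y3 : q ^ (2 : ℤ) = q ^ 2 := by norm_cast
  norm_num only [zpow_one] at r1 r1' r2 r2' r3 r3' c1 c2 s1 s2 ⊢
  rw [c1, c2]
  rw [r1] at r1'
  rw [r2] at r2'
  rw [r3] at r3'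
  clear c1 c2 r1 r2 r3 t1
  simp only [z1, z2, z3, z3', z4, y1, y2, y3, ← s2, s1] at r1' r2' r3' ⊢
  field_simp at r1' r2' r3' ⊢
  linear_combination q * r1' + q * q ^ m * r2' + q ^ m * r3'

lemma bilatSum_sub_eq {q : ℂ} (hq : ‖q‖ < 1) (h0 : q ≠ 0) (n : ℕ) :
    bilatSum q 1 n n - bilatSum q 1 (n - 1) (n + 1) = q ^ n ^ 2 * (qPoch q (2 * n))⁻¹ := by
  induction n with
  | zero =>
    have e1 : bilatSum q 1 0 0 = 1 := by
      unfold bilatSum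
      rw [tsum_eq_single 0]
      · simp [qPochInv, qPoch]
      · intro r hr
        rcases lt_or_gt_of_ne hr with h | h
        · rw [qPochInv_of_neg q (by omega : 0 + 3 * r < 0), mul_zero, mul_zero]
        · rw [qPochInv_of_neg q (by omega : 0 - 3 * r < 0), zero_mul, mul_zero]
    have e2 : bilatSum q 1 (-1) 1 = 0 := by
      unfold bilatSum
      rw [← tsum_zero (α := ℂ) (β := ℤ)]
      refine tsum_congr fun r => ?_
      rcases lt_or_ge r 0 with h | h
      · simp [qPochInv_of_neg q (by omega : 1 + 3 * r < 0)]
      · simp [qPochInv_of_neg q (by omega : -1 - 3 * r < 0)]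
    simp [e1, e2, qPoch]
  | succ n ih =>
    have h1 := bilatSum_half_step hq h0 n
    have h2 := bilatSum_half_step' hq h0 (n + 1)
    rw [show (n : ℤ) + 1 - 2 = n - 1 by ring, show (n : ℤ) + 1 + 1 = n + 2 by ring,
      show (n : ℤ) + 1 - 1 = n by ring,
      show 2 * ((n : ℤ) + 1) = (2 * n + 1 + 1 : ℕ) by push_cast; ring,
      show ((2 * n + 1 + 1 : ℕ) : ℤ) - 1 = (2 * n + 1 : ℕ) by push_cast; ring,
      zpow_natCast, zpow_natCast] at h2
    rw [ih, show (2 * (n : ℤ) + 1) = (2 * n + 1 : ℕ) by push_cast; ring, zpow_natCast] at h1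
    have n1 := one_sub_pow_ne_zero hq (Nat.succ_ne_zero (2 * n))
    have n2 := one_sub_pow_ne_zero hq (Nat.succ_ne_zero (2 * n + 1))
    have n3 := qPoch_ne_zero hq (2 * n)
    push_cast
    rw [show (n : ℤ) + 1 + 1 = n + 2 by ring, show (n : ℤ) + 1 - 1 = n by ring,
      show 2 * (n + 1) = 2 * n + 1 + 1 by ring, qPoch_succ, qPoch_succ]
    refine mul_left_cancel₀ n2 (h2.trans ?_)
    rw [eq_div_of_mul_eq n1 ((mul_comm _ _).trans h1.symm)]
    simp only [Nat.succ_eq_add_one] at n1 n2 ⊢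
    field_simp
    ring

/-- A Bailey pair relative to `q`, in bilateral form. -/
lemma tsum_bailey {q : ℂ} (hq : ‖q‖ < 1) (h0 : q ≠ 0) (n : ℕ) :
    ∑' r : ℤ, (q ^ (3 * r ^ 2 - 2 * r) - q ^ (3 * r ^ 2 + 4 * r + 1)) *
      (qPochInv q (n - 3 * r) * qPochInv q (n + 1 + 3 * r)) =
        q ^ (n ^ 2 - n) * (qPoch q (2 * n))⁻¹ := by
  have e1 := bilatSum_pred_right hq h0 1 n (n + 1)
  have e2 := bilatSum_pred_left hq h0 1 n (n + 1)
  have e3 := bilatSum_sub_eq hq h0 n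
  rw [add_sub_cancel_right] at e1
  rw [e1, e2] at e3
  have e4 : ∑' r : ℤ, (q ^ (3 * r ^ 2 - 2 * r) - q ^ (3 * r ^ 2 + 4 * r + 1)) *
      (qPochInv q (n - 3 * r) * qPochInv q (n + 1 + 3 * r)) =
      bilatSum q (1 - 3) n (n + 1) - q * bilatSum q (1 + 3) n (n + 1) := by
    unfold bilatSum
    rw [← tsum_mul_left, ← Summable.tsum_sub (summable_bilatSum q _ _ _)
      ((summable_bilatSum q _ _ _).mul_left _)]
    refine tsum_congr fun r => ?_
    rw [zpow_add_one₀ h0]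
    ring_nf
  rw [e4]
  have hn : n ^ 2 = n ^ 2 - n + n := (Nat.sub_add_cancel (Nat.le_self_pow two_ne_zero n)).symm
  rw [hn, pow_add, zpow_add_one₀ h0, zpow_natCast] at e3
  refine mul_left_cancel₀ (pow_ne_zero n h0) ?_
  linear_combination e3

lemma tendsto_qPoch {q : ℂ} (hq : ‖q‖ < 1) :
    ∃ l ≠ 0, Filter.Tendsto (qPoch q) Filter.atTop (nhds l) := by
  have hs : Summable fun n : ℕ => ‖-q ^ (n + 1)‖ := by
    simpa [norm_pow] using
      (summable_nat_add_iff 1).mpr (summable_geometric_of_lt_one (norm_nonneg q) hq)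
  refine ⟨∏' n : ℕ, (1 + -q ^ (n + 1)), tprod_one_add_ne_zero_of_summable (fun n => ?_) hs, ?_⟩
  · simpa [sub_eq_add_neg] using one_sub_pow_ne_zero hq n.succ_ne_zero
  · exact (multipliable_one_add_of_summable hs).tendsto_prod_tprod_nat.congr fun n => by
      simp only [qPoch, sub_eq_add_neg]

lemma exists_norm_qPoch_le {q : ℂ} (hq : ‖q‖ < 1) : ∃ C, ∀ n, ‖qPoch q n‖ ≤ C := by
  obtain ⟨l, -, hl⟩ := tendsto_qPoch hq
  obtain ⟨C, hC⟩ := (Metric.isBounded_range_of_tendsto _ hl).exists_norm_le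
  exact ⟨C, fun n => hC _ ⟨n, rfl⟩⟩

lemma exists_norm_qPochInv_le {q : ℂ} (hq : ‖q‖ < 1) : ∃ C, ∀ k, ‖qPochInv q k‖ ≤ C := by
  obtain ⟨l, hl0, hl⟩ := tendsto_qPoch hq
  obtain ⟨C, hC⟩ := (Metric.isBounded_range_of_tendsto _ (hl.inv₀ hl0)).exists_norm_le
  have hC' (n : ℕ) : ‖(qPoch q n)⁻¹‖ ≤ C := hC _ ⟨n, rfl⟩
  refine ⟨C, fun k => ?_⟩
  unfold qPochInv
  split_ifs
  · simpa using (norm_nonneg _).trans (hC' 0)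
  · exact hC' _

/-- The terms of the series conjugate to the Bailey kernel. -/
noncomputable def conjTerm (q : ℂ) (j : ℤ) (n : ℕ) : ℂ :=
  (-1) ^ n * q ^ (n + 1).choose 2 * qPoch q n * (qPochInv q (n - j) * qPochInv q (n + 1 + j))

lemma choose_succ_two_succ (n : ℕ) : (n + 1 + 1).choose 2 = (n + 1).choose 2 + (n + 1) := by
  rw [Nat.choose_succ_succ' (n + 1) 1, Nat.choose_one_right, add_comm]

lemma two_mul_choose_succ_two (n : ℕ) : 2 * (n + 1).choose 2 = n * (n + 1) := by
  induction n with
  | zero => rfl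
  | succ n ih => rw [choose_succ_two_succ, mul_add, ih]; ring

lemma le_choose_succ_two (n : ℕ) : n ≤ (n + 1).choose 2 := by
  have := two_mul_choose_succ_two n
  nlinarith [Nat.le_self_pow two_ne_zero n]

lemma exists_norm_conjTerm_le {q : ℂ} (hq : ‖q‖ < 1) :
    ∃ K, 0 ≤ K ∧ ∀ j n, ‖conjTerm q j n‖ ≤ K * ‖q‖ ^ n := by
  obtain ⟨C, hC⟩ := exists_norm_qPoch_le hq
  obtain ⟨D, hD⟩ := exists_norm_qPochInv_le hq
  have hC0 := (norm_nonneg _).trans (hC 0)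
  have hD0 := (norm_nonneg _).trans (hD 0)
  refine ⟨C * (D * D), by positivity, fun j n => ?_⟩
  have h1 : ‖q‖ ^ (n + 1).choose 2 ≤ ‖q‖ ^ n :=
    pow_le_pow_of_le_one (norm_nonneg _) hq.le (le_choose_succ_two n)
  unfold conjTerm
  simp only [norm_mul, norm_pow, norm_neg, norm_one, one_pow, one_mul]
  calc ‖q‖ ^ (n + 1).choose 2 * ‖qPoch q n‖ *
        (‖qPochInv q (n - j)‖ * ‖qPochInv q (n + 1 + j)‖)
      ≤ ‖q‖ ^ n * C * (D * D) := by
        gcongr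
        exacts [hC _, hD _, hD _]
    _ = C * (D * D) * ‖q‖ ^ n := by ring

lemma summable_conjTerm {q : ℂ} (hq : ‖q‖ < 1) (j : ℤ) : Summable (conjTerm q j) := by
  obtain ⟨K, -, hK⟩ := exists_norm_conjTerm_le hq
  exact Summable.of_norm_bounded ((summable_geometric_of_lt_one (norm_nonneg q) hq).mul_left K)
    (hK j)

lemma conjTerm_reflect (q : ℂ) (j : ℤ) (n : ℕ) : conjTerm q (-1 - j) n = conjTerm q j n := by
  unfold conjTerm
  rw [mul_comm (qPochInv q _)]
  ring_nf

lemma hasSum_of_telescoping {f g : ℕ → ℂ} {l : ℂ} (hf : Summable f)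
    (hfg : ∀ n, f n = g (n + 1) - g n) (hg : Filter.Tendsto g Filter.atTop (nhds l)) :
    HasSum f (l - g 0) := by
  rw [hf.hasSum_iff_tendsto_nat]
  simp only [hfg, Finset.sum_range_sub]
  exact hg.sub_const _

lemma tendsto_zero_of_norm_le_geometric {q : ℂ} (hq : ‖q‖ < 1) {g : ℕ → ℂ} {K : ℝ}
    (h : ∀ n, ‖g n‖ ≤ K * ‖q‖ ^ n) : Filter.Tendsto g Filter.atTop (nhds 0) :=
  squeeze_zero_norm h <| by
    simpa using (tendsto_pow_atTop_nhds_zero_of_lt_one (norm_nonneg q) hq).const_mul K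

/-- The sum of the conjugate Bailey series. -/
lemma hasSum_conjTerm {q : ℂ} (hq : ‖q‖ < 1) (h0 : q ≠ 0) (j : ℕ) :
    HasSum (conjTerm q j) ((-1) ^ j * q ^ (j + 1).choose 2) := by
  obtain ⟨C, hC⟩ := exists_norm_qPoch_le hq
  obtain ⟨D, hD⟩ := exists_norm_qPochInv_le hq
  have hC0 := (norm_nonneg _).trans (hC 0)
  have hD0 := (norm_nonneg _).trans (hD 0)
  have hT (n : ℕ) : ‖q‖ ^ (n + 1).choose 2 ≤ ‖q‖ ^ n :=
    pow_le_pow_of_le_one (norm_nonneg _) hq.le (le_choose_succ_two n)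
  induction j with
  | zero =>
    have key := hasSum_of_telescoping (summable_conjTerm hq 0)
      (g := fun n => -((-1) ^ n * q ^ (n + 1).choose 2 * qPochInv q n)) (l := 0) ?_ ?_
    · simpa [qPochInv, qPoch] using key
    · intro n
      have h1 := one_sub_zpow_mul_qPochInv hq (n + 1)
      rw [add_sub_cancel_right] at h1
      have h2 : qPoch q n * qPochInv q n = 1 := by
        rw [qPochInv_natCast, mul_inv_cancel₀ (qPoch_ne_zero hq n)]
      have h3 : q ^ ((n : ℤ) + 1) = q ^ (n + 1) := by norm_cast
      unfold conjTerm
      rw [choose_succ_two_succ, pow_succ, pow_add q]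
      push_cast
      rw [sub_zero, add_zero]
      rw [h3] at h1
      linear_combination ((-1) ^ n * q ^ (n + 1).choose 2 * qPochInv q (n + 1)) * h2 +
        ((-1) ^ n * q ^ (n + 1).choose 2) * h1
    · refine tendsto_zero_of_norm_le_geometric hq (K := D) fun n => ?_
      simp only [norm_mul, norm_pow, norm_neg, norm_one, one_pow, one_mul]
      rw [mul_comm]
      exact mul_le_mul (hD _) (hT n) (by positivity) hD0
  | succ j ih =>
    have key := hasSum_of_telescoping (l := 0)
      (g := fun n => -(1 + q ^ (j + 1)) * ((-1) ^ n * q ^ (n + 1).choose 2 * qPoch q n *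
        (qPochInv q (n - (j + 1)) * qPochInv q (n + 1 + j))))
      ((summable_conjTerm hq (j + 1)).add ((summable_conjTerm hq j).mul_left (q ^ (j + 1)))) ?_ ?_
    · have h := key.sub (ih.mul_left (q ^ (j + 1)))
      simp only [add_sub_cancel_right] at h
      rw [qPochInv_of_neg q (by push_cast; omega : ((0 : ℕ) : ℤ) - (j + 1) < 0)] at h
      rw [Nat.cast_succ, choose_succ_two_succ, pow_add q, pow_succ (-1 : ℂ)]
      have hval : (-1) ^ j * -1 * (q ^ (j + 1).choose 2 * q ^ (j + 1)) =
          0 - -(1 + q ^ (j + 1)) * ((-1) ^ 0 * q ^ (0 + 1).choose 2 * qPoch q 0 *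
            (0 * qPochInv q ((0 : ℕ) + 1 + j))) -
              q ^ (j + 1) * ((-1) ^ j * q ^ (j + 1).choose 2) := by ring
      rw [hval]
      exact h
    · intro n
      have h1 := one_sub_zpow_mul_qPochInv hq (n - j)
      have h2 := one_sub_zpow_mul_qPochInv hq (n + 1 + (j + 1))
      rw [show (n : ℤ) - j - 1 = n - (j + 1) by ring, zpow_sub₀ h0, zpow_natCast,
        zpow_natCast] at h1
      rw [show (n : ℤ) + 1 + (j + 1) - 1 = n + 1 + j by ring,
        show q ^ ((n : ℤ) + 1 + (j + 1)) = q ^ n * q ^ j * q ^ 2 by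
          rw [← pow_add, ← pow_add, ← zpow_natCast]; push_cast; ring_nf] at h2
      have hj := pow_ne_zero j h0
      unfold conjTerm
      rw [choose_succ_two_succ, pow_succ (-1 : ℂ), pow_add q, qPoch_succ]
      push_cast
      rw [show (n : ℤ) + 1 - (j + 1) = n - j by ring,
        show (n : ℤ) + 1 + 1 + j = n + 1 + (j + 1) by ring, ← h1, ← h2]
      field_simp
      ring
    · have hg : ∀ n : ℕ, ‖(-1) ^ n * q ^ (n + 1).choose 2 * qPoch q n *
          (qPochInv q (n - (j + 1)) * qPochInv q (n + 1 + j))‖ ≤ C * (D * D) * ‖q‖ ^ n := by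
        intro n
        simp only [norm_mul, norm_pow, norm_neg, norm_one, one_pow, one_mul]
        calc ‖q‖ ^ (n + 1).choose 2 * ‖qPoch q n‖ *
              (‖qPochInv q (n - (j + 1))‖ * ‖qPochInv q (n + 1 + j)‖)
            ≤ ‖q‖ ^ n * C * (D * D) := by
              have := hT n
              gcongr
              exacts [hC _, hD _, hD _]
          _ = C * (D * D) * ‖q‖ ^ n := by ring
      simpa using (tendsto_zero_of_norm_le_geometric hq hg).const_mul (-(1 + q ^ (j + 1)))

/-- The bilateral weights of the Bailey pair. -/
noncomputable def baileyWeight (q : ℂ) (r : ℤ) : ℂ :=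
  q ^ (3 * r ^ 2 - 2 * r) - q ^ (3 * r ^ 2 + 4 * r + 1)

lemma baileyWeight_natCast (q : ℂ) (n : ℕ) :
    baileyWeight q n = q ^ (3 * n ^ 2 - 2 * n) - q ^ (3 * n ^ 2 + 4 * n + 1) := by
  have h : 2 * n ≤ 3 * n ^ 2 := by nlinarith [Nat.le_self_pow two_ne_zero n]
  unfold baileyWeight
  rw [← zpow_natCast, ← zpow_natCast]
  push_cast [h]
  rfl

lemma baileyWeight_neg_succ (q : ℂ) (n : ℕ) :
    baileyWeight q (-(n + 1)) = q ^ (3 * n ^ 2 + 8 * n + 5) - q ^ (3 * n ^ 2 + 2 * n) := by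
  unfold baileyWeight
  rw [← zpow_natCast, ← zpow_natCast]
  push_cast
  ring_nf

lemma norm_pow_sub_pow_le {q : ℂ} (hq : ‖q‖ < 1) {n a b : ℕ} (ha : n ≤ a) (hb : n ≤ b) :
    ‖q ^ a - q ^ b‖ ≤ 2 * ‖q‖ ^ n := by
  have h1 := pow_le_pow_of_le_one (norm_nonneg q) hq.le ha
  have h2 := pow_le_pow_of_le_one (norm_nonneg q) hq.le hb
  have h3 := norm_sub_le (q ^ a) (q ^ b)
  rw [norm_pow, norm_pow] at h3
  linarith

lemma summable_norm_baileyWeight {q : ℂ} (hq : ‖q‖ < 1) :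
    Summable fun r : ℤ => ‖baileyWeight q r‖ := by
  have hs := (summable_geometric_of_lt_one (norm_nonneg q) hq).mul_left 2
  refine Summable.of_nat_of_neg_add_one ?_ ?_
  · refine Summable.of_nonneg_of_le (fun _ => norm_nonneg _) (fun n => ?_) hs
    rw [baileyWeight_natCast]
    have := Nat.le_self_pow two_ne_zero n
    exact norm_pow_sub_pow_le hq (by omega) (by omega)
  · refine Summable.of_nonneg_of_le (fun _ => norm_nonneg _) (fun n => ?_) hs
    rw [baileyWeight_neg_succ]
    exact norm_pow_sub_pow_le hq (by nlinarith) (by nlinarith)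

lemma prod_one_sub_pow_add {q : ℂ} (hq : ‖q‖ < 1) (n : ℕ) :
    ∏ k ∈ Finset.range n, (1 - q ^ (n + k + 1)) = qPoch q (2 * n) / qPoch q n := by
  rw [eq_div_iff (qPoch_ne_zero hq n), two_mul, qPoch, qPoch, Finset.prod_range_add, mul_comm]

lemma hypergeometric_term_eq {q : ℂ} (hq : ‖q‖ < 1) (n : ℕ) :
    (-1 : ℂ) ^ n * q ^ (n * (3 * n - 1) / 2) / ∏ k ∈ Finset.range n, (1 - q ^ (n + k + 1)) =
      (-1) ^ n * q ^ (n + 1).choose 2 * qPoch q n *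
        (q ^ (n ^ 2 - n) * (qPoch q (2 * n))⁻¹) := by
  have he : n * (3 * n - 1) / 2 = (n + 1).choose 2 + (n ^ 2 - n) := by
    have h1 := two_mul_choose_succ_two n
    have h2 := Nat.le_self_pow two_ne_zero n
    have h3 : n * (3 * n - 1) + n = 3 * n ^ 2 := by
      rcases n with _ | n
      · rfl
      · rw [show 3 * (n + 1) - 1 = 3 * n + 2 by omega]
        ring
    have h4 : n * (n + 1) = n ^ 2 + n := by ring
    omega
  rw [prod_one_sub_pow_add hq, he, pow_add]
  have h1 := qPoch_ne_zero hq n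
  have h2 := qPoch_ne_zero hq (2 * n)
  field_simp

lemma summable_norm_hypergeometric {q : ℂ} (hq : ‖q‖ < 1) :
    Summable fun n : ℕ => ‖(-1 : ℂ) ^ n * q ^ (n * (3 * n - 1) / 2) /
      ∏ k ∈ Finset.range n, (1 - q ^ (n + k + 1))‖ := by
  obtain ⟨C, hC⟩ := exists_norm_qPoch_le hq
  obtain ⟨D, hD⟩ := exists_norm_qPochInv_le hq
  have hC0 := (norm_nonneg _).trans (hC 0)
  have hD0 := (norm_nonneg _).trans (hD 0)
  refine Summable.of_nonneg_of_le (fun _ => norm_nonneg _) (fun n => ?_)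
    ((summable_geometric_of_lt_one (norm_nonneg q) hq).mul_left (C * D))
  rw [hypergeometric_term_eq hq, ← qPochInv_natCast]
  have h1 : ‖q‖ ^ (n + 1).choose 2 ≤ ‖q‖ ^ n :=
    pow_le_pow_of_le_one (norm_nonneg _) hq.le (le_choose_succ_two n)
  have h2 : ‖q‖ ^ (n ^ 2 - n) ≤ 1 := pow_le_one₀ (norm_nonneg _) hq.le
  simp only [norm_mul, norm_pow, norm_neg, norm_one, one_pow, one_mul]
  calc ‖q‖ ^ (n + 1).choose 2 * ‖qPoch q n‖ *
        (‖q‖ ^ (n ^ 2 - n) * ‖qPochInv q (2 * n : ℕ)‖)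
      ≤ ‖q‖ ^ n * C * (1 * D) := by
        gcongr
        exacts [hC _, hD _]
    _ = C * D * ‖q‖ ^ n := by ring

/-- The hypergeometric series as a bilateral theta-like series, by Bailey's lemma. -/
lemma tsum_hypergeometric_eq {q : ℂ} (hq : ‖q‖ < 1) (h0 : q ≠ 0) :
    ∑' n : ℕ, (-1 : ℂ) ^ n * q ^ (n * (3 * n - 1) / 2) /
        ∏ k ∈ Finset.range n, (1 - q ^ (n + k + 1)) =
      ∑' r : ℤ, baileyWeight q r * ∑' n : ℕ, conjTerm q (3 * r) n := by
  have h1 (n : ℕ) : (-1 : ℂ) ^ n * q ^ (n * (3 * n - 1) / 2) /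
      ∏ k ∈ Finset.range n, (1 - q ^ (n + k + 1)) =
        ∑' r : ℤ, baileyWeight q r * conjTerm q (3 * r) n := by
    rw [hypergeometric_term_eq hq, ← tsum_bailey hq h0, ← tsum_mul_left]
    refine tsum_congr fun r => ?_
    unfold baileyWeight conjTerm
    ring
  simp only [h1, ← tsum_mul_left]
  obtain ⟨K, hK0, hK⟩ := exists_norm_conjTerm_le hq
  refine Summable.tsum_comm (f := fun (r : ℤ) (n : ℕ) => baileyWeight q r * conjTerm q (3 * r) n) ?_
  refine Summable.of_norm_bounded ((summable_norm_baileyWeight hq).mul_of_nonneg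
    ((summable_geometric_of_lt_one (norm_nonneg q) hq).mul_left K) (fun _ => norm_nonneg _)
    (fun _ => by positivity)) ?_
  rintro ⟨r, n⟩
  simp only [Function.uncurry_apply_pair, norm_mul]
  exact mul_le_mul_of_nonneg_left (hK _ _) (norm_nonneg _)

/-- The partial false theta series over the progression `c + 30 m`. -/
noncomputable def thetaPart (q : ℂ) (c : ℕ) : ℂ :=
  ∑' m : ℕ, (-1) ^ m * q ^ (((c + 30 * m) ^ 2 - 1) / 120)

lemma summable_thetaPart {q : ℂ} (hq : ‖q‖ < 1) {c : ℕ} (hc : 1 ≤ c) :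
    Summable fun m : ℕ => (-1) ^ m * q ^ (((c + 30 * m) ^ 2 - 1) / 120) := by
  refine Summable.of_norm_bounded (summable_geometric_of_lt_one (norm_nonneg q) hq) fun m => ?_
  simp only [norm_mul, norm_pow, norm_neg, norm_one, one_pow, one_mul]
  refine pow_le_pow_of_le_one (norm_nonneg _) hq.le ?_
  rw [Nat.le_div_iff_mul_le (by norm_num)]
  refine Nat.le_sub_of_add_le ?_
  nlinarith [Nat.le_self_pow two_ne_zero m]

lemma exponent_eq {e N : ℕ} (h : 120 * e + 1 = N ^ 2) : (N ^ 2 - 1) / 120 = e := by omega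

lemma thetaPart_succ {q : ℂ} (hq : ‖q‖ < 1) {c : ℕ} (hc : 1 ≤ c) :
    thetaPart q c = q ^ ((c ^ 2 - 1) / 120) - thetaPart q (c + 30) := by
  unfold thetaPart
  rw [(summable_thetaPart hq hc).tsum_eq_zero_add, sub_eq_add_neg, ← tsum_neg]
  congr 1
  · simp
  · refine tsum_congr fun m => ?_
    rw [pow_succ (-1 : ℂ), show c + 30 * (m + 1) = c + 30 + 30 * m by ring]
    ring

lemma tsum_hypergeometric_eq_thetaPart {q : ℂ} (hq : ‖q‖ < 1) (h0 : q ≠ 0) :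
    ∑' n : ℕ, (-1 : ℂ) ^ n * q ^ (n * (3 * n - 1) / 2) /
        ∏ k ∈ Finset.range n, (1 - q ^ (n + k + 1)) =
      2 - (thetaPart q 1 + thetaPart q 11 + thetaPart q 19 + thetaPart q 29) := by
  have hpos (n : ℕ) : baileyWeight q n * ∑' k : ℕ, conjTerm q (3 * n) k =
      (-1) ^ n * q ^ (((30 * n - 1) ^ 2 - 1) / 120) -
        (-1) ^ n * q ^ (((11 + 30 * n) ^ 2 - 1) / 120) := by
    have h := (hasSum_conjTerm hq h0 (3 * n)).tsum_eq
    have hT := two_mul_choose_succ_two (3 * n)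
    have e1 : ((30 * n - 1) ^ 2 - 1) / 120 = (3 * n + 1).choose 2 + (3 * n ^ 2 - 2 * n) := by
      rcases n with _ | n
      · rfl
      · refine exponent_eq ?_
        rw [show 3 * (n + 1) ^ 2 - 2 * (n + 1) = 3 * n ^ 2 + 4 * n + 1 by
          rw [Nat.sub_eq_iff_eq_add (by nlinarith)]; ring,
          show 30 * (n + 1) - 1 = 30 * n + 29 by omega]
        linarith
    have e2 : ((11 + 30 * n) ^ 2 - 1) / 120 =
        (3 * n + 1).choose 2 + (3 * n ^ 2 + 4 * n + 1) := exponent_eq (by linarith)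
    push_cast at h
    rw [h, baileyWeight_natCast, e1, e2, pow_add q, pow_add q, pow_mul (-1 : ℂ)]
    norm_num
    ring
  have hneg (n : ℕ) : baileyWeight q (-(n + 1)) * ∑' k : ℕ, conjTerm q (3 * (-(n + 1))) k =
      (-1) ^ n * q ^ (((31 + 30 * n) ^ 2 - 1) / 120) -
        (-1) ^ n * q ^ (((19 + 30 * n) ^ 2 - 1) / 120) := by
    have h := (hasSum_conjTerm hq h0 (3 * n + 2)).tsum_eq
    have hT := two_mul_choose_succ_two (3 * n + 2)
    have e1 : ((31 + 30 * n) ^ 2 - 1) / 120 =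
        (3 * n + 2 + 1).choose 2 + (3 * n ^ 2 + 8 * n + 5) := exponent_eq (by linarith)
    have e2 : ((19 + 30 * n) ^ 2 - 1) / 120 =
        (3 * n + 2 + 1).choose 2 + (3 * n ^ 2 + 2 * n) := exponent_eq (by linarith)
    have e3 : 3 * (-((n : ℤ) + 1)) = -1 - (3 * n + 2 : ℕ) := by push_cast; ring
    rw [e3]
    simp only [conjTerm_reflect]
    rw [h, baileyWeight_neg_succ, e1, e2, pow_add q, pow_add q, pow_add (-1 : ℂ), pow_mul (-1 : ℂ)]
    norm_num
    ring
  have hshift (n : ℕ) : (-1 : ℂ) ^ (n + 1) * q ^ (((30 * (n + 1) - 1) ^ 2 - 1) / 120) =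
      -((-1) ^ n * q ^ (((29 + 30 * n) ^ 2 - 1) / 120)) := by
    rw [show 30 * (n + 1) - 1 = 29 + 30 * n by omega, pow_succ (-1 : ℂ)]
    ring
  have s0 : Summable fun n : ℕ => (-1 : ℂ) ^ n * q ^ (((30 * n - 1) ^ 2 - 1) / 120) := by
    rw [← summable_nat_add_iff 1]
    simp only [hshift]
    exact (summable_thetaPart hq (by norm_num)).neg
  have t0 : ∑' n : ℕ, (-1 : ℂ) ^ n * q ^ (((30 * n - 1) ^ 2 - 1) / 120) =
      1 - thetaPart q 29 := by
    rw [s0.tsum_eq_zero_add]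
    simp only [hshift, tsum_neg]
    simp [thetaPart, sub_eq_add_neg]
  have s11 := summable_thetaPart hq (c := 11) (by norm_num)
  have s19 := summable_thetaPart hq (c := 19) (by norm_num)
  have s31 := summable_thetaPart hq (c := 31) (by norm_num)
  have h31 := thetaPart_succ hq (c := 1) le_rfl
  rw [tsum_hypergeometric_eq hq h0, tsum_of_nat_of_neg_add_one]
  · simp only [hpos, hneg]
    rw [s0.tsum_sub s11, s31.tsum_sub s19, t0]
    change 1 - thetaPart q 29 - thetaPart q 11 + (thetaPart q 31 - thetaPart q 19) = _
    norm_num at h31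
    linear_combination h31
  · simpa only [hpos] using s0.sub s11
  · simpa only [hneg] using s31.sub s19

lemma eps60_add_thirty_mul (c m : ℕ) : (eps60 (c + 30 * m) : ℂ) = eps60 c * (-1) ^ m := by
  induction m with
  | zero => simp
  | succ m ih =>
    have h : eps60 (c + 30 * (m + 1)) = -eps60 (c + 30 * m) := by
      unfold eps60
      split_ifs <;> omega
    rw [h, Int.cast_neg, ih, pow_succ]
    ring

lemma summable_norm_eps60 {q : ℂ} (hq : ‖q‖ < 1) :
    Summable fun n : ℕ => ‖(eps60 (n + 1) : ℂ) * q ^ (((n + 1) ^ 2 - 1) / 120)‖ := by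
  rw [← summable_nat_add_iff 60]
  refine Summable.of_nonneg_of_le (fun _ => norm_nonneg _) (fun n => ?_)
    (summable_geometric_of_lt_one (norm_nonneg q) hq)
  have h1 (k : ℕ) : ‖(eps60 k : ℂ)‖ ≤ 1 := by
    unfold eps60
    split_ifs <;> simp
  rw [norm_mul, norm_pow, ← one_mul (‖q‖ ^ n)]
  refine mul_le_mul (h1 _) (pow_le_pow_of_le_one (norm_nonneg _) hq.le ?_) (by positivity)
    zero_le_one
  rw [Nat.le_div_iff_mul_le (by norm_num)]
  refine Nat.le_sub_of_add_le ?_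
  nlinarith

lemma tsum_eps60_eq_thetaPart {q : ℂ} (hq : ‖q‖ < 1) :
    ∑' n : ℕ, (eps60 (n + 1) : ℂ) * q ^ (((n + 1) ^ 2 - 1) / 120) =
      thetaPart q 1 + thetaPart q 11 + thetaPart q 19 + thetaPart q 29 := by
  have h (j : ℕ) : ∑' m : ℕ, (eps60 (j + 30 * m + 1) : ℂ) *
      q ^ (((j + 30 * m + 1) ^ 2 - 1) / 120) = eps60 (j + 1) * thetaPart q (j + 1) := by
    unfold thetaPart
    rw [← tsum_mul_left]
    refine tsum_congr fun m => ?_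
    rw [add_right_comm, eps60_add_thirty_mul]
    ring
  rw [Nat.sumByResidueClasses (summable_norm_eps60 hq).of_norm 30]
  simp only [h]
  refine (Fin.sum_univ_eq_sum_range
    (fun j => (eps60 (j + 1) : ℂ) * thetaPart q (j + 1)) 30).trans ?_
  simp [Finset.sum_range_succ, eps60]

/-- the false theta function `q^{−1/120}Ψ^{30+6,10,15}_1`
(the homological block of the Poincaré sphere `Σ(2,3,5)`) as a
`q`-hypergeometric series:
`Σ_{n≥1} ε₆₀(n) q^{(n²−1)/120} = 2 − Σ_{n≥0} (−1)ⁿ q^{n(3n−1)/2}/(q^{n+1};q)_n`. -/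
theorem falseTheta_Sigma235_qHypergeometric (q : ℂ) (hq : ‖q‖ < 1) :
    (Summable fun n : ℕ =>
      ‖(eps60 (n + 1) : ℂ) * q ^ (((n + 1) ^ 2 - 1) / 120)‖) ∧
    (Summable fun n : ℕ =>
      ‖(-1 : ℂ) ^ n * q ^ (n * (3 * n - 1) / 2) /
        ∏ k ∈ Finset.range n, (1 - q ^ (n + k + 1))‖) ∧
    ∑' n : ℕ, (eps60 (n + 1) : ℂ) * q ^ (((n + 1) ^ 2 - 1) / 120) =
      2 - ∑' n : ℕ, (-1 : ℂ) ^ n * q ^ (n * (3 * n - 1) / 2) /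
        ∏ k ∈ Finset.range n, (1 - q ^ (n + k + 1)) := by
  refine ⟨summable_norm_eps60 hq, summable_norm_hypergeometric hq, ?_⟩
  rcases eq_or_ne q 0 with rfl | h0
  · rw [tsum_eq_single 0, tsum_eq_single 0]
    · norm_num [eps60]
    · intro n hn
      have : n * (3 * n - 1) / 2 ≠ 0 := by
        have h : 1 * 2 ≤ n * (3 * n - 1) := Nat.mul_le_mul (by omega) (by omega)
        omega
      rw [zero_pow this, mul_zero, zero_div]
    · intro n hn
      rcases lt_or_ge n 10 with h | h
      · have : eps60 (n + 1) = 0 := by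
          unfold eps60
          split_ifs <;> omega
        rw [this, Int.cast_zero, zero_mul]
      · have : ((n + 1) ^ 2 - 1) / 120 ≠ 0 := by
          have h : 11 ^ 2 ≤ (n + 1) ^ 2 := Nat.pow_le_pow_left (by omega) 2
          omega
        rw [zero_pow this, mul_zero]
  · rw [tsum_eps60_eq_thetaPart hq, tsum_hypergeometric_eq_thetaPart hq h0, sub_sub_cancel]
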